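/- Let 0 < λ ≤ 1 with λ ≠ 1/2. For every real polynomial f whose Gegenbauer coefficient f̂_0^λ vanishes, letting g be the real polynomial with ĝ_0^λ = 0 and ĝ_n^λ = (n(n+2λ))^{1/2} f̂_n^λ for all n ≥ 1, one has c_λ ∫_{−1}^{1} f(t)² w_λ(t) dt ≤ (8/(2λ−1)²) · c_λ ∫_{−1}^{1} (1−t) g(t)² w_λ(t) dt. -/

import Mathlib

open MeasureTheory Real

/-- The Gegenbauer weight `w_λ(t) = (1-t²)^{λ-1/2}` on `[-1,1]`. -/
noncomputable def gegenWeight (lam t : ℝ) : ℝ := (1 - t ^ 2) ^ (lam - 1 / 2)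

/-- The normalization constant `c_λ = Γ(λ+1)/(√π Γ(λ+1/2))`,
so that `c_λ ∫_{-1}^1 w_λ(t) dt = 1`. -/
noncomputable def gegenConst (lam : ℝ) : ℝ :=
  Real.Gamma (lam + 1) / (Real.sqrt Real.pi * Real.Gamma (lam + 1 / 2))

/-- The Gegenbauer polynomials `C_n^λ`, defined by the three-term recurrence
`C_0^λ(t) = 1`, `C_1^λ(t) = 2λt`,
`n C_n^λ(t) = 2(n+λ-1) t C_{n-1}^λ(t) - (n+2λ-2) C_{n-2}^λ(t)`. -/
noncomputable def gegenPoly (lam : ℝ) : ℕ → ℝ → ℝ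
  | 0 => fun _ => 1
  | 1 => fun t => 2 * lam * t
  | (n + 2) => fun t =>
      (2 * ((n : ℝ) + 2 + lam - 1) * t * gegenPoly lam (n + 1) t
        - ((n : ℝ) + 2 + 2 * lam - 2) * gegenPoly lam n t) / ((n : ℝ) + 2)

/-- The normalization `h_n^λ = λ (2λ)_n / ((n+λ) n!)`. -/
noncomputable def gegenNorm (lam : ℝ) (n : ℕ) : ℝ :=
  lam * (ascPochhammer ℝ n).eval (2 * lam) / (((n : ℝ) + lam) * (n.factorial : ℝ))

/-- The Gegenbauer coefficients
`f̂_n^λ = (h_n^λ)^{-1/2} c_λ ∫_{-1}^1 f(s) C_n^λ(s) w_λ(s) ds`. -/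
noncomputable def gegenCoeff (lam : ℝ) (f : ℝ → ℝ) (n : ℕ) : ℝ :=
  (Real.sqrt (gegenNorm lam n))⁻¹ * gegenConst lam *
    ∫ s in (-1 : ℝ)..1, f s * gegenPoly lam n s * gegenWeight lam s

/-- `γ_n = ((n+2λ)(n+1)/((n+λ)(n+λ+1)))^{1/2}`. -/
noncomputable def gegenGamma (lam : ℝ) (n : ℕ) : ℝ :=
  Real.sqrt (((n : ℝ) + 2 * lam) * ((n : ℝ) + 1) / (((n : ℝ) + lam) * ((n : ℝ) + lam + 1)))

open Polynomial in
/-- The Gegenbauer polynomials as elements of `ℝ[X]`. -/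
noncomputable def gegenPolynomial (lam : ℝ) : ℕ → ℝ[X]
  | 0 => 1
  | 1 => C (2 * lam) * X
  | (n + 2) => C ((n : ℝ) + 2)⁻¹ * (C (2 * ((n : ℝ) + 1 + lam)) * (X * gegenPolynomial lam (n + 1))
      - C ((n : ℝ) + 2 * lam) * gegenPolynomial lam n)

section GegenbauerAlgebra

open Polynomial

variable {lam : ℝ}

theorem eval_gegenPolynomial (lam : ℝ) (n : ℕ) (t : ℝ) :
    (gegenPolynomial lam n).eval t = gegenPoly lam n t := by
  induction n using Nat.twoStepInduction with
  | zero => simp [gegenPolynomial, gegenPoly]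
  | one => simp [gegenPolynomial, gegenPoly]
  | more n ih1 ih2 =>
    simp only [gegenPolynomial, gegenPoly, eval_mul, eval_sub, eval_C, eval_X, ih1, ih2]
    ring

theorem gegenPolynomial_recurrence (lam : ℝ) (n : ℕ) :
    C ((n : ℝ) + 2) * gegenPolynomial lam (n + 2) =
      C (2 * ((n : ℝ) + 1 + lam)) * (X * gegenPolynomial lam (n + 1))
        - C ((n : ℝ) + 2 * lam) * gegenPolynomial lam n := by
  rw [gegenPolynomial, ← mul_assoc, ← C_mul, mul_inv_cancel₀ (by positivity), C_1, one_mul]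

/-- The two first-order differential relations linking consecutive Gegenbauer polynomials. -/
theorem gegenPolynomial_derivative_relations (lam : ℝ) (n : ℕ) :
    (1 - X ^ 2) * derivative (gegenPolynomial lam n) =
        C ((n : ℝ) + 2 * lam) * (X * gegenPolynomial lam n)
          - C ((n : ℝ) + 1) * gegenPolynomial lam (n + 1) ∧
      (1 - X ^ 2) * derivative (gegenPolynomial lam (n + 1)) =
        C ((n : ℝ) + 2 * lam) * gegenPolynomial lam n
          - C ((n : ℝ) + 1) * (X * gegenPolynomial lam (n + 1)) := by
  induction n with
  | zero =>
    constructor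
    · simp [gegenPolynomial]
    · simp [gegenPolynomial]
      ring
  | succ n ih =>
    obtain ⟨h1, h2⟩ := ih
    have hr := gegenPolynomial_recurrence lam n
    have hd := congrArg derivative hr
    simp only [derivative_mul, derivative_sub, derivative_C, derivative_X, zero_mul, zero_add,
      one_mul] at hd
    have hne : (C ((n : ℝ) + 2) : ℝ[X]) ≠ 0 := by
      rw [Ne, C_eq_zero]; positivity
    simp only [C_add, C_mul, C_1, C_ofNat, Nat.cast_add, Nat.cast_one, add_assoc,
      Nat.reduceAdd] at *
    norm_num at *
    constructor
    · linear_combination h2 + hr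
    · refine mul_left_cancel₀ hne ?_
      linear_combination (1 - X ^ 2) * hd + 2 * ((n : ℝ[X]) + (1 + C lam)) * X * h2
        - ((n : ℝ[X]) + 2 * C lam) * h1 + (n + 2) * X * hr

theorem gegenNorm_zero (hlam : 0 < lam) : gegenNorm lam 0 = 1 := by
  simp [gegenNorm, hlam.ne']

theorem gegenNorm_succ (hlam : 0 < lam) (n : ℕ) :
    gegenNorm lam (n + 1) =
      gegenNorm lam n * (((n : ℝ) + 2 * lam) * (n + lam) / ((n + 1) * (n + 1 + lam))) := by
  have h1 : (n : ℝ) + lam ≠ 0 := by positivity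
  have h2 : (n : ℝ) + 1 + lam ≠ 0 := by positivity
  have h3 : (n.factorial : ℝ) ≠ 0 := by positivity
  simp only [gegenNorm, ascPochhammer_succ_eval, Nat.factorial_succ, Nat.cast_mul, Nat.cast_add,
    Nat.cast_one]
  field_simp
  ring

theorem gegenNorm_pos (hlam : 0 < lam) (n : ℕ) : 0 < gegenNorm lam n := by
  induction n with
  | zero => rw [gegenNorm_zero hlam]; exact one_pos
  | succ n ih => rw [gegenNorm_succ hlam]; positivity

theorem span_gegenPolynomial (hlam : 0 < lam) :
    Submodule.span ℝ (Set.range (gegenPolynomial lam)) = ⊤ := by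
  set S := Submodule.span ℝ (Set.range (gegenPolynomial lam))
  have hmem (n : ℕ) : gegenPolynomial lam n ∈ S := Submodule.subset_span ⟨n, rfl⟩
  have hmul : ∀ p ∈ S, X * p ∈ S := by
    intro p hp
    induction hp using Submodule.span_induction with
    | mem p hp =>
      obtain ⟨n, rfl⟩ := hp
      rcases n with _ | n
      · have h : X * gegenPolynomial lam 0 = (2 * lam)⁻¹ • gegenPolynomial lam 1 := by
          rw [smul_eq_C_mul, gegenPolynomial, gegenPolynomial, ← mul_assoc, ← C_mul,
            inv_mul_cancel₀ (by positivity), C_1]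
          ring
        rw [h]
        exact S.smul_mem _ (hmem 1)
      · have h : X * gegenPolynomial lam (n + 1) = (2 * ((n : ℝ) + 1 + lam))⁻¹ •
            (((n : ℝ) + 2) • gegenPolynomial lam (n + 2)
              + ((n : ℝ) + 2 * lam) • gegenPolynomial lam n) := by
          simp only [smul_eq_C_mul]
          rw [gegenPolynomial_recurrence, sub_add_cancel, ← mul_assoc, ← C_mul,
            inv_mul_cancel₀ (by positivity), C_1, one_mul]
        rw [h]
        exact S.smul_mem _ (S.add_mem (S.smul_mem _ (hmem _)) (S.smul_mem _ (hmem _)))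
    | zero => simp
    | add p q _ _ hp hq => rw [mul_add]; exact S.add_mem hp hq
    | smul a p _ hp => rw [mul_smul_comm]; exact S.smul_mem _ hp
  refine eq_top_iff.2 fun p _ => ?_
  have hone : (1 : ℝ[X]) ∈ S := hmem 0
  have hpow (k : ℕ) : (X : ℝ[X]) ^ k ∈ S := by
    induction k with
    | zero => simpa using hone
    | succ k ih => rw [pow_succ']; exact hmul _ ih
  rw [p.as_sum_range_C_mul_X_pow]
  refine S.sum_mem fun k _ => ?_
  rw [← smul_eq_C_mul]
  exact S.smul_mem _ (hpow k)

theorem exists_gegenPolynomial_expansion (hlam : 0 < lam) (p : ℝ[X]) :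
    ∃ a : ℕ →₀ ℝ, ∀ N, (∀ k ∈ a.support, k < N) →
      p = ∑ k ∈ Finset.range N, a k • gegenPolynomial lam k := by
  have hp : p ∈ Submodule.span ℝ (Set.range (gegenPolynomial lam)) := by
    rw [span_gegenPolynomial hlam]; trivial
  obtain ⟨a, rfl⟩ := Finsupp.mem_span_range_iff_exists_finsupp.1 hp
  refine ⟨a, fun N hN => ?_⟩
  rw [Finsupp.sum]
  refine Finset.sum_subset (fun k hk => Finset.mem_range.2 (hN k hk)) fun k _ hk => ?_
  rw [Finsupp.notMem_support_iff.1 hk, zero_smul]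

variable {L : ℝ[X] →ₗ[ℝ] ℝ}

theorem map_C_mul_eq (L : ℝ[X] →ₗ[ℝ] ℝ) (a : ℝ) (p : ℝ[X]) : L (C a * p) = a * L p := by
  rw [← smul_eq_C_mul, map_smul, smul_eq_mul]

theorem map_gegenPolynomial_succ (hlam : 0 < lam)
    (hL : ∀ q, L ((1 - X ^ 2) * derivative q - C (2 * lam + 1) * (X * q)) = 0) (n : ℕ) :
    L (gegenPolynomial lam (n + 1)) = 0 := by
  have key (n : ℕ) : ((n : ℝ) - 1) * L (X * gegenPolynomial lam n)
      = (n + 1) * L (gegenPolynomial lam (n + 1)) := by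
    have h := hL (gegenPolynomial lam n)
    rw [(gegenPolynomial_derivative_relations lam n).1] at h
    simp only [map_sub, map_C_mul_eq] at h
    linear_combination h
  have hrec (n : ℕ) := congrArg L (gegenPolynomial_recurrence lam n)
  simp only [map_sub, map_C_mul_eq] at hrec
  induction n using Nat.twoStepInduction with
  | zero =>
    have h1 : L (gegenPolynomial lam 1) = 2 * lam * L (X * gegenPolynomial lam 0) := by
      rw [← map_C_mul_eq]
      simp [gegenPolynomial]
    have h2 := key 0
    simp only [Nat.cast_zero, zero_add] at h2
    have : (2 * lam + 1) * L (gegenPolynomial lam 1) = 0 := by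
      linear_combination h1 - 2 * lam * h2
    exact (mul_eq_zero.1 this).resolve_left (by positivity)
  | one =>
    have h := key 1
    norm_num at h
    exact h
  | more n ih1 _ =>
    have h1 := key (n + 2)
    have h2 := hrec (n + 1)
    push_cast at h1 h2
    have : ((n : ℝ) + 3) * (n + 3 + 2 * lam) * L (gegenPolynomial lam (n + 2 + 1)) = 0 := by
      rw [ih1] at h2
      linear_combination -((n : ℝ) + 1) * h2 - 2 * (n + 2 + lam) * h1
    exact (mul_eq_zero.1 this).resolve_left (by positivity)

theorem map_gegenPolynomial_mul_aux (hlam : 0 < lam)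
    (hL : ∀ q, L ((1 - X ^ 2) * derivative q - C (2 * lam + 1) * (X * q)) = 0) (m : ℕ) :
    L (gegenPolynomial lam m * gegenPolynomial lam m) = gegenNorm lam m * L 1 ∧
      ∀ n, m < n → L (gegenPolynomial lam m * gegenPolynomial lam n) = 0 := by
  have hrec (n : ℕ) (q : ℝ[X]) : ((n : ℝ) + 2) * L (gegenPolynomial lam (n + 2) * q)
      = 2 * (n + 1 + lam) * L (X * gegenPolynomial lam (n + 1) * q)
        - (n + 2 * lam) * L (gegenPolynomial lam n * q) := by
    simp only [← map_C_mul_eq, ← map_sub]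
    congr 1
    linear_combination q * gegenPolynomial_recurrence lam n
  induction m using Nat.twoStepInduction with
  | zero =>
    refine ⟨by simp [gegenPolynomial, gegenNorm_zero hlam], fun n hn => ?_⟩
    obtain ⟨n, rfl⟩ := Nat.exists_eq_add_of_lt hn
    simpa [gegenPolynomial] using map_gegenPolynomial_succ hlam hL n
  | one =>
    have h0 (n : ℕ) : L (gegenPolynomial lam (n + 1)) = 0 := map_gegenPolynomial_succ hlam hL n
    have h1 (n : ℕ) : ((n : ℝ) + 1 + lam) *
        L (gegenPolynomial lam 1 * gegenPolynomial lam (n + 1))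
          = lam * ((n + 2 * lam) * L (gegenPolynomial lam n)) := by
      have h := hrec n 1
      have h2 : L (gegenPolynomial lam 1 * gegenPolynomial lam (n + 1))
          = 2 * lam * L (X * gegenPolynomial lam (n + 1)) := by
        rw [← map_C_mul_eq]
        simp [gegenPolynomial, mul_assoc]
      simp only [mul_one, h0] at h
      rw [h2]
      linear_combination -lam * h
    constructor
    · have h := h1 0
      have h3 := gegenNorm_succ hlam 0
      rw [gegenNorm_zero hlam] at h3
      simp only [Nat.cast_zero, zero_add] at h h3
      have hne : 1 + lam ≠ 0 := by positivity
      refine mul_left_cancel₀ hne ?_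
      rw [h, h3]
      simp only [gegenPolynomial]
      field_simp
    · intro n hn
      obtain ⟨n, rfl⟩ := Nat.exists_eq_add_of_lt hn
      have h := h1 (n + 1)
      rw [h0, mul_zero, mul_zero] at h
      rw [add_comm 1 n]
      exact (mul_eq_zero.1 h).resolve_left (by positivity)
  | more m ih1 ih2 =>
    have h1 (n : ℕ) (hn : m < n) : ((n : ℝ) + 1 + lam) * ((m + 2) *
        L (gegenPolynomial lam (m + 2) * gegenPolynomial lam (n + 1)))
          = (m + 1 + lam) * ((n + 2 * lam) *
            L (gegenPolynomial lam (m + 1) * gegenPolynomial lam n)) := by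
      have ha := hrec m (gegenPolynomial lam (n + 1))
      have hb := hrec n (gegenPolynomial lam (m + 1))
      rw [ih1.2 (n + 1) (by lia)] at ha
      rw [mul_comm (gegenPolynomial lam (n + 2)), ih2.2 (n + 2) (by lia),
        mul_comm (gegenPolynomial lam n)] at hb
      rw [show X * gegenPolynomial lam (n + 1) * gegenPolynomial lam (m + 1)
        = X * gegenPolynomial lam (m + 1) * gegenPolynomial lam (n + 1) by ring] at hb
      linear_combination ((n : ℝ) + 1 + lam) * ha - (m + 1 + lam) * hb
    constructor
    · have h := h1 (m + 1) (by lia)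
      have h3 := gegenNorm_succ hlam (m + 1)
      rw [ih2.1] at h
      push_cast at h h3
      have hne : (m + 1 + 1 + lam) * ((m : ℝ) + 2) ≠ 0 := by positivity
      refine mul_left_cancel₀ hne ?_
      rw [h3, mul_assoc, h]
      have : (m : ℝ) + 1 + 1 + lam ≠ 0 := by positivity
      have : (m : ℝ) + 1 + 1 ≠ 0 := by positivity
      field_simp
      ring
    · intro n hn
      obtain ⟨n, rfl⟩ := Nat.exists_eq_add_of_lt hn
      have h := h1 (m + 2 + n) (by lia)
      rw [ih2.2 _ (by lia), mul_zero, mul_zero, ← mul_assoc] at h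
      exact (mul_eq_zero.1 h).resolve_left (by positivity)

theorem map_gegenPolynomial_mul (hlam : 0 < lam)
    (hL : ∀ q, L ((1 - X ^ 2) * derivative q - C (2 * lam + 1) * (X * q)) = 0) (m n : ℕ) :
    L (gegenPolynomial lam m * gegenPolynomial lam n) =
      if m = n then gegenNorm lam n * L 1 else 0 := by
  rcases lt_trichotomy m n with h | rfl | h
  · rw [if_neg h.ne, (map_gegenPolynomial_mul_aux hlam hL m).2 n h]
  · rw [if_pos rfl, (map_gegenPolynomial_mul_aux hlam hL m).1]
  · rw [if_neg h.ne', mul_comm, (map_gegenPolynomial_mul_aux hlam hL n).2 m h]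

theorem map_sum_mul_gegenPolynomial (hlam : 0 < lam)
    (hL : ∀ q, L ((1 - X ^ 2) * derivative q - C (2 * lam + 1) * (X * q)) = 0)
    (a : ℕ → ℝ) (N n : ℕ) :
    L ((∑ k ∈ Finset.range N, a k • gegenPolynomial lam k) * gegenPolynomial lam n) =
      if n < N then a n * (gegenNorm lam n * L 1) else 0 := by
  simp [Finset.sum_mul, map_gegenPolynomial_mul hlam hL]

theorem map_sum_sq (hlam : 0 < lam)
    (hL : ∀ q, L ((1 - X ^ 2) * derivative q - C (2 * lam + 1) * (X * q)) = 0)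
    (a : ℕ → ℝ) (N : ℕ) :
    L ((∑ k ∈ Finset.range N, a k • gegenPolynomial lam k) ^ 2) =
      (∑ k ∈ Finset.range N, gegenNorm lam k * a k ^ 2) * L 1 := by
  rw [sq, Finset.mul_sum, map_sum, Finset.sum_mul]
  refine Finset.sum_congr rfl fun k hk => ?_
  rw [mul_smul_comm, map_smul, smul_eq_mul, map_sum_mul_gegenPolynomial hlam hL,
    if_pos (Finset.mem_range.1 hk)]
  ring

/-- Pointwise inequality for the ground-state substitution. -/
theorem gegen_potential_bound (hlam : 0 < lam) (hlam1 : lam ≤ 1) (n : ℕ) :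
    (2 * lam - 1) ^ 2 / 8 / (((n : ℝ) + 1) * (n + 1 + 2 * lam)) ≤
      1 - (n + 2 * lam) * (n + 1) / (2 * ((n + 1 + lam) * (n + lam + 1 / 2)))
        - (n + 1 + lam + 1 / 2) / (2 * (n + 1 + lam)) := by
  have h1 : 0 < (n : ℝ) + 1 + lam := by positivity
  have h2 : 0 < (n : ℝ) + lam + 1 / 2 := by positivity
  have e : 1 - (n + 2 * lam) * (n + 1) / (2 * ((n + 1 + lam) * (n + lam + 1 / 2)))
        - ((n : ℝ) + 1 + lam + 1 / 2) / (2 * (n + 1 + lam))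
      = (2 * lam - 1) ^ 2 / 8 / ((n + 1 + lam) * (n + lam + 1 / 2)) := by
    field_simp
    ring
  rw [e]
  refine div_le_div_of_nonneg_left (by positivity) (by positivity) ?_
  have hn : (0 : ℝ) ≤ n := by positivity
  nlinarith

/-- The discrete Hardy inequality behind the Gegenbauer inequality, with the remainder term
that makes it inductive. -/
theorem gegen_hardy_rellich_partial_sum (hlam : 0 < lam) (hlam1 : lam ≤ 1)
    (hL : ∀ q, L ((1 - X ^ 2) * derivative q - C (2 * lam + 1) * (X * q)) = 0) (hpos : 0 < L 1)
    (a b : ℕ → ℝ) (ha : a 0 = 0) (hb : b 0 = 0)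
    (hab : ∀ n : ℕ, 1 ≤ n → b n ^ 2 = n * (n + 2 * lam) * a n ^ 2) (n : ℕ) :
    ((2 * lam - 1) ^ 2 / 8 * (∑ k ∈ Finset.range (n + 1), gegenNorm lam k * a k ^ 2)
        + (n + lam + 1 / 2) / (2 * (n + lam)) * gegenNorm lam n * b n ^ 2) * L 1 ≤
      L ((1 - X) * (∑ k ∈ Finset.range (n + 1), b k • gegenPolynomial lam k) ^ 2) := by
  induction n with
  | zero => simp [ha, hb]
  | succ n ih =>
    set g := ∑ k ∈ Finset.range (n + 1), b k • gegenPolynomial lam k with hg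
    have hrec (q : ℝ[X]) : 2 * ((n : ℝ) + 1 + lam) * L (X * gegenPolynomial lam (n + 1) * q)
        = (n + 2) * L (q * gegenPolynomial lam (n + 2))
          + (n + 2 * lam) * L (q * gegenPolynomial lam n) := by
      simp only [← map_C_mul_eq, ← map_add]
      congr 1
      linear_combination -q * gegenPolynomial_recurrence lam n
    have h1 : 2 * ((n : ℝ) + 1 + lam) * L (X * gegenPolynomial lam (n + 1) * g)
        = (n + 2 * lam) * (b n * (gegenNorm lam n * L 1)) := by
      rw [hrec, hg, map_sum_mul_gegenPolynomial hlam hL, map_sum_mul_gegenPolynomial hlam hL,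
        if_neg (by lia), if_pos (by lia), mul_zero, zero_add]
    have h2 : L (X * gegenPolynomial lam (n + 1) * gegenPolynomial lam (n + 1)) = 0 := by
      have h := hrec (gegenPolynomial lam (n + 1))
      rw [map_gegenPolynomial_mul hlam hL, map_gegenPolynomial_mul hlam hL, if_neg (by lia),
        if_neg (by lia), mul_zero, mul_zero, add_zero] at h
      exact (mul_eq_zero.1 h).resolve_left (by positivity)
    have h3 : L (g * gegenPolynomial lam (n + 1)) = 0 := by
      rw [hg, map_sum_mul_gegenPolynomial hlam hL, if_neg (by lia)]
    have h4 := (map_gegenPolynomial_mul_aux hlam hL (n + 1)).1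
    have hexp : L ((1 - X) * (g + b (n + 1) • gegenPolynomial lam (n + 1)) ^ 2)
        = L ((1 - X) * g ^ 2) + b (n + 1) ^ 2 * (gegenNorm lam (n + 1) * L 1)
          - 2 * b (n + 1) * L (X * gegenPolynomial lam (n + 1) * g) := by
      have e : (1 - X) * (g + b (n + 1) • gegenPolynomial lam (n + 1)) ^ 2
          = (1 - X) * g ^ 2 + C (2 * b (n + 1)) * (g * gegenPolynomial lam (n + 1))
            - C (2 * b (n + 1)) * (X * gegenPolynomial lam (n + 1) * g)
            + C (b (n + 1) ^ 2) * (gegenPolynomial lam (n + 1) * gegenPolynomial lam (n + 1))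
            - C (b (n + 1) ^ 2)
              * (X * gegenPolynomial lam (n + 1) * gegenPolynomial lam (n + 1)) := by
        simp only [smul_eq_C_mul, C_mul, C_pow, C_ofNat]
        ring
      rw [e]
      simp only [map_add, map_sub, map_C_mul_eq, h2, h3, h4]
      ring
    rw [Finset.sum_range_succ, Finset.sum_range_succ _ (n + 1), ← hg, hexp]
    have hh := gegenNorm_pos hlam n
    have hh' := gegenNorm_pos hlam (n + 1)
    have hs := gegenNorm_succ hlam n
    have p1 : 0 < (n : ℝ) + lam := by positivity
    have p2 : 0 < (n : ℝ) + 1 + lam := by positivity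
    have p3 : 0 < (n : ℝ) + lam + 1 / 2 := by positivity
    have hcross : 2 * b (n + 1) * L (X * gegenPolynomial lam (n + 1) * g) ≤
        ((n + lam + 1 / 2) / (2 * (n + lam)) * gegenNorm lam n * b n ^ 2
          + (n + 2 * lam) * (n + 1) / (2 * ((n + 1 + lam) * (n + lam + 1 / 2)))
            * gegenNorm lam (n + 1) * b (n + 1) ^ 2) * L 1 := by
      have e1 : L (X * gegenPolynomial lam (n + 1) * g)
          = (n + 2 * lam) * (b n * (gegenNorm lam n * L 1)) / (2 * ((n : ℝ) + 1 + lam)) := by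
        rw [← h1]; field_simp
      have e2 : ((n + lam + 1 / 2) / (2 * (n + lam)) * gegenNorm lam n * b n ^ 2
          + (n + 2 * lam) * (n + 1) / (2 * ((n + 1 + lam) * (n + lam + 1 / 2)))
            * gegenNorm lam (n + 1) * b (n + 1) ^ 2) * L 1
          - 2 * b (n + 1) * L (X * gegenPolynomial lam (n + 1) * g)
          = gegenNorm lam n * L 1 * ((n + lam + 1 / 2) / (2 * (n + lam)))
            * (b n - (n + 2 * lam) * (n + lam) / ((n + 1 + lam) * (n + lam + 1 / 2))
              * b (n + 1)) ^ 2 := by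
        rw [e1, hs]
        field_simp
        ring
      rw [← sub_nonneg, e2]
      positivity
    have hpot := gegen_potential_bound hlam hlam1 n
    have hab' := hab (n + 1) (by lia)
    push_cast at hab' ⊢
    have hpot' : (2 * lam - 1) ^ 2 / 8 * (gegenNorm lam (n + 1) * a (n + 1) ^ 2) ≤
        (1 - (n + 2 * lam) * (n + 1) / (2 * ((n + 1 + lam) * (n + lam + 1 / 2)))
          - (n + 1 + lam + 1 / 2) / (2 * (n + 1 + lam)))
            * (gegenNorm lam (n + 1) * b (n + 1) ^ 2) := by
      refine le_trans (le_of_eq ?_)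
        (mul_le_mul_of_nonneg_right hpot (by positivity))
      rw [hab']
      field_simp
    have hpot'' := mul_le_mul_of_nonneg_right hpot' hpos.le
    linarith

end GegenbauerAlgebra

section GegenbauerIntegral

open Polynomial

variable {lam : ℝ}

theorem gegenWeight_pos (lam : ℝ) {t : ℝ} (ht : t ∈ Set.Ioo (-1 : ℝ) 1) : 0 < gegenWeight lam t :=
  Real.rpow_pos_of_pos (by nlinarith [ht.1, ht.2]) _

theorem intervalIntegrable_gegenWeight (hlam : 0 < lam) :
    IntervalIntegrable (gegenWeight lam) volume (-1) 1 := by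
  have h := Polynomial.Chebyshev.intervalIntegrable_sqrt_one_sub_sq_inv
  rw [intervalIntegrable_iff, Set.uIoc_of_le (by norm_num), integrableOn_Ioc_iff_integrableOn_Ioo]
    at h ⊢
  refine Integrable.mono' h ?_ ?_
  · unfold gegenWeight
    exact Measurable.aestronglyMeasurable (by fun_prop)
  · filter_upwards [ae_restrict_mem measurableSet_Ioo] with t ht
    have ht0 : 0 < 1 - t ^ 2 := by nlinarith [ht.1, ht.2]
    rw [Real.norm_of_nonneg (gegenWeight_pos lam ht).le, Real.sqrt_inv, Real.sqrt_eq_rpow,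
      ← Real.rpow_neg ht0.le]
    exact Real.rpow_le_rpow_of_exponent_ge ht0 (by nlinarith) (by linarith)

theorem intervalIntegrable_eval_mul_gegenWeight (hlam : 0 < lam) (p : ℝ[X]) :
    IntervalIntegrable (fun t => p.eval t * gegenWeight lam t) volume (-1) 1 :=
  (intervalIntegrable_gegenWeight hlam).continuousOn_mul p.continuousOn

/-- Integration of polynomials against the Gegenbauer weight. -/
noncomputable def gegenFunctional (hlam : 0 < lam) : ℝ[X] →ₗ[ℝ] ℝ where
  toFun p := ∫ t in (-1 : ℝ)..1, p.eval t * gegenWeight lam t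
  map_add' p q := by
    rw [← intervalIntegral.integral_add (intervalIntegrable_eval_mul_gegenWeight hlam p)
      (intervalIntegrable_eval_mul_gegenWeight hlam q)]
    simp only [eval_add, add_mul]
  map_smul' a p := by
    simp only [eval_smul, smul_eq_mul, mul_assoc, intervalIntegral.integral_const_mul,
      RingHom.id_apply]

theorem gegenFunctional_apply (hlam : 0 < lam) (p : ℝ[X]) :
    gegenFunctional hlam p = ∫ t in (-1 : ℝ)..1, p.eval t * gegenWeight lam t := rfl

theorem gegenFunctional_one_pos (hlam : 0 < lam) : 0 < gegenFunctional hlam 1 := by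
  simp only [gegenFunctional_apply, eval_one, one_mul]
  exact intervalIntegral.intervalIntegral_pos_of_pos_on (intervalIntegrable_gegenWeight hlam)
    (fun t ht => gegenWeight_pos lam ht) (by norm_num)

/-- The Gegenbauer weight satisfies its Pearson equation in weak form. -/
theorem gegenFunctional_pearson (hlam : 0 < lam) (q : ℝ[X]) :
    gegenFunctional hlam ((1 - X ^ 2) * derivative q - C (2 * lam + 1) * (X * q)) = 0 := by
  rw [gegenFunctional_apply, intervalIntegral.integral_eq_sub_of_hasDerivAt_of_le (by norm_num)
    (f := fun t => (1 - t ^ 2) ^ (lam + 1 / 2) * q.eval t)]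
  · norm_num [Real.zero_rpow (show lam + 1 / 2 ≠ 0 by positivity)]
  · refine ContinuousOn.mul ?_ q.continuousOn
    exact ContinuousOn.rpow_const (by fun_prop) fun t _ => Or.inr (by positivity)
  · intro t ht
    have ht0 : 0 < 1 - t ^ 2 := by nlinarith [ht.1, ht.2]
    have h1 : HasDerivAt (fun t : ℝ => 1 - t ^ 2) (-(2 * t)) t := by
      simpa using ((hasDerivAt_id t).pow 2).const_sub 1
    refine ((h1.rpow_const (p := lam + 1 / 2) (Or.inl ht0.ne')).mul
      (q.hasDerivAt t)).congr_deriv ?_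
    have e1 : (1 - t ^ 2) ^ (lam + 1 / 2) = (1 - t ^ 2) * (1 - t ^ 2) ^ (lam - 1 / 2) := by
      rw [show lam + 1 / 2 = 1 + (lam - 1 / 2) by ring, Real.rpow_add ht0, Real.rpow_one]
    rw [show lam + 1 / 2 - 1 = lam - 1 / 2 by ring, e1, gegenWeight]
    simp only [eval_sub, eval_mul, eval_one, eval_pow, eval_X, eval_C]
    ring
  · exact intervalIntegrable_eval_mul_gegenWeight hlam _

theorem gegenConst_pos (hlam : 0 < lam) : 0 < gegenConst lam :=
  div_pos (Real.Gamma_pos_of_pos (by positivity))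
    (mul_pos (Real.sqrt_pos.2 Real.pi_pos) (Real.Gamma_pos_of_pos (by positivity)))

theorem gegenCoeff_sum (hlam : 0 < lam) (a : ℕ → ℝ) (N n : ℕ) (hn : n < N) :
    gegenCoeff lam
        (fun t => (∑ k ∈ Finset.range N, a k • gegenPolynomial lam k).eval t) n =
      gegenConst lam * gegenFunctional hlam 1 * Real.sqrt (gegenNorm lam n) * a n := by
  have h := map_sum_mul_gegenPolynomial hlam (gegenFunctional_pearson hlam) a N n
  rw [if_pos hn, gegenFunctional_apply] at h
  simp only [eval_mul, eval_gegenPolynomial] at h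
  rw [gegenCoeff, h]
  have hs : 0 < Real.sqrt (gegenNorm lam n) := Real.sqrt_pos.2 (gegenNorm_pos hlam n)
  nth_rewrite 2 [← Real.sq_sqrt (gegenNorm_pos hlam n).le]
  field_simp

end GegenbauerIntegral

/-- **Theorem 3.4 (sharp constant for `0 < λ ≤ 1`, `λ ≠ 1/2`).** For every real polynomial
`f` with `f̂_0^λ = 0` and `g` the polynomial with `ĝ_0^λ = 0`,
`ĝ_n^λ = (n(n+2λ))^{1/2} f̂_n^λ` for `n ≥ 1`, one has
`c_λ ∫_{-1}^1 f² w_λ ≤ (8/(2λ-1)²) c_λ ∫_{-1}^1 (1-t) g² w_λ`. -/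
theorem hardy_rellich_gegenbauer_sharp (lam : ℝ) (hlam0 : 0 < lam) (hlam1 : lam ≤ 1)
    (hlamhalf : lam ≠ 1 / 2) (f g : Polynomial ℝ)
    (hf0 : gegenCoeff lam (fun t => f.eval t) 0 = 0)
    (hg0 : gegenCoeff lam (fun t => g.eval t) 0 = 0)
    (hg : ∀ n : ℕ, 1 ≤ n →
      gegenCoeff lam (fun t => g.eval t) n =
        Real.sqrt ((n : ℝ) * ((n : ℝ) + 2 * lam)) * gegenCoeff lam (fun t => f.eval t) n) :
    gegenConst lam * ∫ t in (-1 : ℝ)..1, (f.eval t) ^ 2 * gegenWeight lam t ≤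
      (8 / (2 * lam - 1) ^ 2) *
        (gegenConst lam * ∫ t in (-1 : ℝ)..1, (1 - t) * (g.eval t) ^ 2 * gegenWeight lam t) := by
  obtain ⟨a, ha⟩ := exists_gegenPolynomial_expansion hlam0 f
  obtain ⟨b, hb⟩ := exists_gegenPolynomial_expansion hlam0 g
  obtain ⟨N, hN⟩ : ∃ N, ∀ k ∈ a.support ∪ b.support, k < N + 1 :=
    ⟨(a.support ∪ b.support).sup id, fun k hk => Nat.lt_succ_of_le (Finset.le_sup (f := id) hk)⟩
  have hfe := ha (N + 1) fun k hk => hN k (Finset.mem_union_left _ hk)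
  have hge := hb (N + 1) fun k hk => hN k (Finset.mem_union_right _ hk)
  have hM := gegenFunctional_one_pos hlam0
  have hc := gegenConst_pos hlam0
  have hs (n : ℕ) : 0 < Real.sqrt (gegenNorm lam n) := Real.sqrt_pos.2 (gegenNorm_pos hlam0 n)
  have hfactor (n : ℕ) : gegenConst lam * gegenFunctional hlam0 1 * √(gegenNorm lam n) ≠ 0 :=
    (mul_pos (mul_pos hc hM) (hs n)).ne'
  have hfc (n : ℕ) (hn : n < N + 1) := hfe ▸ gegenCoeff_sum hlam0 a (N + 1) n hn
  have hgc (n : ℕ) (hn : n < N + 1) := hge ▸ gegenCoeff_sum hlam0 b (N + 1) n hn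
  have ha0 : a 0 = 0 := by
    rw [hfc 0 (by lia)] at hf0
    exact (mul_eq_zero.1 hf0).resolve_left (hfactor 0)
  have hb0 : b 0 = 0 := by
    rw [hgc 0 (by lia)] at hg0
    exact (mul_eq_zero.1 hg0).resolve_left (hfactor 0)
  have hab (n : ℕ) (hn : 1 ≤ n) : b n ^ 2 = n * (n + 2 * lam) * a n ^ 2 := by
    by_cases hnN : n < N + 1
    · have h := hg n hn
      rw [hfc n hnN, hgc n hnN, mul_left_comm] at h
      rw [mul_left_cancel₀ (hfactor n) h, mul_pow, Real.sq_sqrt (by positivity)]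
    · have h0 : n ∉ a.support ∪ b.support := fun h => hnN (hN n h)
      simp only [Finset.mem_union, Finsupp.mem_support_iff, not_or, not_not] at h0
      simp [h0.1, h0.2]
  have key := gegen_hardy_rellich_partial_sum hlam0 hlam1 (gegenFunctional_pearson hlam0) hM
    a b ha0 hb0 hab N
  rw [add_mul, mul_assoc, ← map_sum_sq hlam0 (gegenFunctional_pearson hlam0), ← hfe, ← hge] at key
  have hrem : 0 ≤ (N + lam + 1 / 2) / (2 * (N + lam)) * gegenNorm lam N * b N ^ 2
      * gegenFunctional hlam0 1 := by
    have := gegenNorm_pos hlam0 N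
    positivity
  have hf2 : ∫ t in (-1 : ℝ)..1, (f.eval t) ^ 2 * gegenWeight lam t
      = gegenFunctional hlam0 (f ^ 2) := by
    simp only [gegenFunctional_apply, Polynomial.eval_pow]
  have hg2 : ∫ t in (-1 : ℝ)..1, (1 - t) * (g.eval t) ^ 2 * gegenWeight lam t
      = gegenFunctional hlam0 ((1 - Polynomial.X) * g ^ 2) := by
    simp only [gegenFunctional_apply, Polynomial.eval_mul, Polynomial.eval_sub,
      Polynomial.eval_one, Polynomial.eval_X, Polynomial.eval_pow]
  rw [hf2, hg2, mul_left_comm]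
  refine mul_le_mul_of_nonneg_left ?_ hc.le
  have hd : 0 < (2 * lam - 1) ^ 2 := by
    have : 2 * lam - 1 ≠ 0 := fun h => hlamhalf (by linarith)
    positivity
  rw [div_mul_eq_mul_div, le_div_iff₀ hd]
  linarith
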